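/- Let n > 3, s ≥ 1 and let Λ = (λ_1,…,λ_n), λ_j ∈ ℂ, be weakly hyperbolic. Let X = (w,z) ∈ Z_{(Λ,n,s)} and let v ∈ T_X be a tangent vector such that dα_X(v,u) = 0 for every u ∈ T_X. Then there exist T ∈ ℂ and μ ∈ ℝ with v = v(T,μ) = −i(2 conj(T) conj(w_1) + μ w_1, …, 2 conj(T) conj(w_s) + μ w_s, (2 Re(T λ_1) + μ) z_1, …, (2 Re(T λ_n) + μ) z_n). -/

import Mathlib

open scoped BigOperators

/-- `Λ` is weakly hyperbolic (`k = 2`). -/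
def WeaklyHyperbolicC {n : ℕ} (Λ : Fin n → ℂ) : Prop :=
  ∀ J : Finset (Fin n), J.card ≤ 2 → (0 : ℂ) ∉ convexHull ℝ (Λ '' ↑J)

/-- The manifold `Z_{(Λ,n,s)} ⊆ ℂ^s × ℂ^n` cut out by
`F_s(w,z) = ∑ w_r² + ∑ λ_j |z_j|² = 0` and `ρ_s(w,z) = ∑ |w_r|² + ∑ |z_j|² = 1`. -/
def ZLS (s : ℕ) {n : ℕ} (Λ : Fin n → ℂ) : Set ((Fin s → ℂ) × (Fin n → ℂ)) :=
  {X | (∑ r, X.1 r ^ 2) + (∑ j, Λ j * (Complex.normSq (X.2 j) : ℂ)) = 0 ∧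
       (∑ r, Complex.normSq (X.1 r)) + (∑ j, Complex.normSq (X.2 j)) = 1}

/-- The tangent space of `Z_{(Λ,n,s)}` at `X = (w,z)`: all `v = (a,b) ∈ ℂ^s × ℂ^n` with
`∑ 2 w_r a_r + ∑ λ_j (conj(z_j) b_j + z_j conj(b_j)) = 0` and
`Re(∑ conj(w_r) a_r + ∑ conj(z_j) b_j) = 0`. -/
def TangentAt (s : ℕ) {n : ℕ} (Λ : Fin n → ℂ)
    (X v : (Fin s → ℂ) × (Fin n → ℂ)) : Prop :=
  ((∑ r, 2 * X.1 r * v.1 r) +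
      (∑ j, Λ j * ((starRingEnd ℂ) (X.2 j) * v.2 j + X.2 j * (starRingEnd ℂ) (v.2 j))) = 0) ∧
  ((∑ r, (starRingEnd ℂ) (X.1 r) * v.1 r) + (∑ j, (starRingEnd ℂ) (X.2 j) * v.2 j)).re = 0

/-- The `1`-form
`α_X(a,b) = i(∑ (w_r conj(a_r) − conj(w_r) a_r) + ∑ (z_j conj(b_j) − conj(z_j) b_j))`. -/
noncomputable def alphaForm {s n : ℕ} (X v : (Fin s → ℂ) × (Fin n → ℂ)) : ℂ :=
  Complex.I *
    ((∑ r, (X.1 r * (starRingEnd ℂ) (v.1 r) - (starRingEnd ℂ) (X.1 r) * v.1 r)) +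
     (∑ j, (X.2 j * (starRingEnd ℂ) (v.2 j) - (starRingEnd ℂ) (X.2 j) * v.2 j)))

/-- The constant `2`-form
`dα(u,v) = 2i(∑ (u_r conj(v_r) − v_r conj(u_r)) + ∑ (u_{s+j} conj(v_{s+j}) − v_{s+j} conj(u_{s+j})))`. -/
noncomputable def dAlpha {s n : ℕ} (u v : (Fin s → ℂ) × (Fin n → ℂ)) : ℂ :=
  2 * Complex.I *
    ((∑ r, (u.1 r * (starRingEnd ℂ) (v.1 r) - v.1 r * (starRingEnd ℂ) (u.1 r))) +
     (∑ j, (u.2 j * (starRingEnd ℂ) (v.2 j) - v.2 j * (starRingEnd ℂ) (u.2 j))))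

/-- The vector `v(T,μ) = −i(2 conj(T) conj(w_1) + μ w_1, …, 2 conj(T) conj(w_s) + μ w_s,
(2 Re(T λ_1) + μ) z_1, …, (2 Re(T λ_n) + μ) z_n)`. -/
noncomputable def vTmu {s n : ℕ} (Λ : Fin n → ℂ) (X : (Fin s → ℂ) × (Fin n → ℂ)) (T : ℂ) (μ : ℝ) :
    (Fin s → ℂ) × (Fin n → ℂ) :=
  (fun r => -Complex.I * (2 * (starRingEnd ℂ) T * (starRingEnd ℂ) (X.1 r) + (μ : ℂ) * X.1 r),
   fun j => -Complex.I * (((2 * (T * Λ j).re + μ : ℝ) : ℂ) * X.2 j))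

/-- The differential of `F_s` at `X`, as a real-linear map. -/
noncomputable def tangentDiff (s : ℕ) {n : ℕ} (Λ : Fin n → ℂ) (X : (Fin s → ℂ) × (Fin n → ℂ)) :
    ((Fin s → ℂ) × (Fin n → ℂ)) →ₗ[ℝ] ℂ where
  toFun u := (∑ r, 2 * X.1 r * u.1 r) +
    (∑ j, Λ j * ((starRingEnd ℂ) (X.2 j) * u.2 j + X.2 j * (starRingEnd ℂ) (u.2 j)))
  map_add' u u' := by
    simp only [Prod.fst_add, Prod.snd_add, Pi.add_apply, map_add, mul_add, Finset.sum_add_distrib]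
    ring
  map_smul' c u := by
    simp only [Prod.smul_fst, Prod.smul_snd, Pi.smul_apply, Complex.real_smul, map_mul,
      Complex.conj_ofReal, RingHom.id_apply, mul_add, Finset.mul_sum, Finset.sum_add_distrib,
      mul_left_comm _ (c : ℂ)]

/-- The Hermitian pairing `u ↦ ⟨X, u⟩`, conjugate-linear in `X`, as a real-linear map. -/
noncomputable def hermitianPairing {s n : ℕ} (X : (Fin s → ℂ) × (Fin n → ℂ)) :
    ((Fin s → ℂ) × (Fin n → ℂ)) →ₗ[ℝ] ℂ where
  toFun u := (∑ r, (starRingEnd ℂ) (X.1 r) * u.1 r) + (∑ j, (starRingEnd ℂ) (X.2 j) * u.2 j)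
  map_add' u u' := by
    simp only [Prod.fst_add, Prod.snd_add, Pi.add_apply, mul_add, Finset.sum_add_distrib]
    ring
  map_smul' c u := by
    simp only [Prod.smul_fst, Prod.smul_snd, Pi.smul_apply, Complex.real_smul,
      RingHom.id_apply, mul_add, Finset.mul_sum, mul_left_comm _ (c : ℂ)]

theorem dAlpha_eq_im_hermitianPairing {s n : ℕ} (v u : (Fin s → ℂ) × (Fin n → ℂ)) :
    dAlpha v u = ((4 * (hermitianPairing v u).im : ℝ) : ℂ) := by
  have h : dAlpha v u = 2 * Complex.I *
      ((starRingEnd ℂ) (hermitianPairing v u) - hermitianPairing v u) := by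
    simp only [dAlpha, hermitianPairing, LinearMap.coe_mk, AddHom.coe_mk, map_add, map_sum,
      map_mul, Complex.conj_conj, Finset.sum_sub_distrib, mul_comm (u.1 _), mul_comm (u.2 _)]
    ring
  rw [h]
  apply Complex.ext <;> simp
  ring

/-- A functional that vanishes on the tangent space is a combination of the differentials of the
defining equations. -/
theorem exists_multipliers_of_tangentAt_le_ker {s n : ℕ} {Λ : Fin n → ℂ}
    {X : (Fin s → ℂ) × (Fin n → ℂ)} (K : ((Fin s → ℂ) × (Fin n → ℂ)) →ₗ[ℝ] ℝ)
    (hK : ∀ u, TangentAt s Λ X u → K u = 0) :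
    ∃ (T : ℂ) (μ : ℝ), ∀ u, K u = (T * tangentDiff s Λ X u).re + μ * (hermitianPairing X u).re := by
  let L : Fin 3 → ((Fin s → ℂ) × (Fin n → ℂ)) →ₗ[ℝ] ℝ :=
    ![Complex.reLm ∘ₗ tangentDiff s Λ X, Complex.imLm ∘ₗ tangentDiff s Λ X,
      Complex.reLm ∘ₗ hermitianPairing X]
  have hmem : K ∈ Submodule.span ℝ (Set.range L) := by
    refine mem_span_of_iInf_ker_le_ker fun u hu => hK u ?_
    simp only [Submodule.mem_iInf, LinearMap.mem_ker] at hu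
    exact ⟨Complex.ext (hu 0) (hu 1), hu 2⟩
  obtain ⟨c, hc⟩ := (Submodule.mem_span_range_iff_exists_fun ℝ).1 hmem
  refine ⟨⟨c 0, -c 1⟩, c 2, fun u => ?_⟩
  rw [← hc]
  simp [L, Fin.sum_univ_three]

/-- A complex number is determined by the real-linear functional `x ↦ Im (conj a * x)`. -/
theorem Complex.eq_neg_I_mul_of_im_conj_mul_eq {a b : ℂ}
    (h : ∀ x : ℂ, ((starRingEnd ℂ) a * x).im = ((starRingEnd ℂ) b * x).re) :
    a = -Complex.I * b := by
  have h₁ := h 1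
  have h₂ := h Complex.I
  simp at h₁ h₂
  apply Complex.ext <;> simp <;> linarith

/-- If `v` is a tangent vector at `X ∈ Z_{(Λ,n,s)}` with `dα_X(v,u) = 0` for every tangent
vector `u` at `X`, then `v = v(T,μ)` for some `T ∈ ℂ` and `μ ∈ ℝ`. -/
theorem kernel_dAlpha_form {n s : ℕ} (hn : 3 < n) (hs : 1 ≤ s)
    (Λ : Fin n → ℂ) (hΛ : WeaklyHyperbolicC Λ)
    (X : (Fin s → ℂ) × (Fin n → ℂ)) (hX : X ∈ ZLS s Λ)
    (v : (Fin s → ℂ) × (Fin n → ℂ)) (hv : TangentAt s Λ X v)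
    (hker : ∀ u : (Fin s → ℂ) × (Fin n → ℂ), TangentAt s Λ X u → dAlpha v u = 0) :
    ∃ (T : ℂ) (μ : ℝ), v = vTmu Λ X T μ := by
  obtain ⟨T, μ, h⟩ := exists_multipliers_of_tangentAt_le_ker
    (Complex.imLm ∘ₗ hermitianPairing v) (fun u hu => by
      have := hker u hu
      rw [dAlpha_eq_im_hermitianPairing, Complex.ofReal_eq_zero] at this
      simpa using this)
  refine ⟨T, μ, Prod.ext (funext fun r => ?_) (funext fun j => ?_)⟩
  · refine Complex.eq_neg_I_mul_of_im_conj_mul_eq fun x => ?_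
    have hx := h (Pi.single r x, 0)
    simp [hermitianPairing, tangentDiff, Pi.single_apply] at hx ⊢
    linarith
  · refine Complex.eq_neg_I_mul_of_im_conj_mul_eq fun x => ?_
    have hx := h (0, Pi.single j x)
    simp [hermitianPairing, tangentDiff, Pi.single_apply, apply_ite (starRingEnd ℂ), mul_add,
      Finset.sum_add_distrib] at hx ⊢
    linarith
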